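/- arXiv:2501.13869 — 2 statements merged into one kernel-verified Lean document; each statement's English description precedes it below -/
import Mathlib

section
/- (Key equality) Let μ be a locally k-uniform measure in ℝ^{n+1} with 0 ∈ supp μ, and 0 < r < 1/2. Assume supp μ ∩ B(0, r₀) is the graph of a C² function φ = (φ_{k+1},…,φ_{n+1}) : ℝ^k → ℝ^{n+1−k} with φ(0) = 0 and ∇φ_j(0) = 0 for all j. Define b̃_{0,r} = ∫_{B(0,r)} (r² − |y|²) y dμ(y). Then (1/2) Σ_{j=k+1}^{n+1} b̃_{0,r}^j Δφ_j(0) = Σ_{j=k+1}^{n+1} ∫_{B(0,r)} y_j² dμ(y). -/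
open MeasureTheory Metric Set Filter Module
open scoped RealInnerProductSpace Topology ENNReal

noncomputable section

/-- `ℝ^{n+1}` as a Euclidean space. -/
abbrev Eu (n : ℕ) := EuclideanSpace ℝ (Fin (n + 1))

/-- `ω_k`: the Lebesgue measure of the unit ball in `ℝ^k`. -/
def unitBallVol (k : ℕ) : ℝ := (volume (ball (0 : EuclideanSpace ℝ (Fin k)) 1)).toReal

/-- The (topological) support of a measure on a metric space. -/
def msupp {X : Type*} [MetricSpace X] [MeasurableSpace X] (μ : Measure X) : Set X :=
  {x | ∀ r : ℝ, 0 < r → 0 < μ (ball x r)}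

/-- `μ` is locally `k`-uniform: `μ(B(x,r)) = ω_k r^k` for `x ∈ supp μ`, `0 < r ≤ 1`. -/
def LocUniform (n k : ℕ) (μ : Measure (Eu n)) : Prop :=
  ∀ x ∈ msupp μ, ∀ r : ℝ, 0 < r → r ≤ 1 →
    μ (ball x r) = ENNReal.ofReal (unitBallVol k * r ^ k)

/-- `μ` is locally uniformly distributed. -/
def LocUnifDist (n : ℕ) (μ : Measure (Eu n)) : Prop :=
  ∀ x ∈ msupp μ, ∀ y ∈ msupp μ, ∀ r : ℝ, 0 < r → r ≤ 1 →
    0 < μ (ball x r) ∧ μ (ball x r) = μ (ball y r) ∧ μ (ball x r) < ⊤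

/-- The graph map of `φ` over `ℝ^k × {0}^{n+1-k}`: `x' ↦ (x', φ(x'))`. -/
def graphMap (n k : ℕ) (φ : Fin (n + 1) → EuclideanSpace ℝ (Fin k) → ℝ) :
    EuclideanSpace ℝ (Fin k) → Eu n := fun x' =>
  (EuclideanSpace.equiv (Fin (n + 1)) ℝ).symm
    (fun j => if h : (j : ℕ) < k then x' ⟨j, h⟩ else φ j x')

/-- The Laplacian of a scalar function at `0`. -/
def lap0 (k : ℕ) (f : EuclideanSpace ℝ (Fin k) → ℝ) : ℝ :=
  ∑ i : Fin k, fderiv ℝ (fun x => fderiv ℝ f x (EuclideanSpace.single i 1)) 0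
    (EuclideanSpace.single i 1)

lemma aux_g (a p : ℝ) :
    |(max 0 (a + p)) ^ 2 - (max 0 a) ^ 2 - 2 * max 0 a * p| ≤ p ^ 2 := by
  rcases le_total 0 (a + p) with h1 | h1 <;> rcases le_total 0 a with h2 | h2 <;>
    simp only [max_eq_left, max_eq_right, h1, h2] <;> rw [abs_le] <;> constructor <;> nlinarith

/-- the radial kernel -/
def hker {n : ℕ} (r : ℝ) (y x : Eu n) : ℝ := (max 0 (r ^ 2 - ‖y - x‖ ^ 2)) ^ 2

lemma hker_cont {n : ℕ} (r : ℝ) (x : Eu n) : Continuous (fun y => hker r y x) := by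
  unfold hker; fun_prop

lemma hker_bd {n : ℕ} (r : ℝ) (x y : Eu n) : |hker r y x| ≤ (r ^ 2) ^ 2 := by
  unfold hker
  rw [abs_of_nonneg (by positivity)]
  have : max 0 (r ^ 2 - ‖y - x‖ ^ 2) ≤ r ^ 2 := max_le (by positivity) (by nlinarith [sq_nonneg ‖y - x‖])
  exact pow_le_pow_left₀ (le_max_left _ _) this 2

lemma fin_ball (n k : ℕ) (μ : Measure (Eu n))
    (hμ : LocUniform n k μ) (h0 : (0 : Eu n) ∈ msupp μ) :
    IsFiniteMeasure (μ.restrict (ball (0 : Eu n) 1)) := by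
  constructor
  rw [Measure.restrict_apply_univ, hμ 0 h0 1 one_pos le_rfl]
  exact ENNReal.ofReal_lt_top

lemma ubv_nonneg (k : ℕ) : 0 ≤ unitBallVol k := ENNReal.toReal_nonneg

lemma ball_real (n k : ℕ) (μ : Measure (Eu n)) (hμ : LocUniform n k μ)
    (x : Eu n) (hx : x ∈ msupp μ) (hx1 : ‖x‖ < 1 / 2) (s : ℝ) (hs : 0 < s) (hs1 : s < 1 / 2) :
    (μ.restrict (ball (0 : Eu n) 1)).real (ball x s) = unitBallVol k * s ^ k := by
  have hsub : ball x s ⊆ ball (0 : Eu n) 1 := by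
    apply ball_subset_ball'
    rw [dist_zero_right]; linarith
  rw [measureReal_def, Measure.restrict_apply measurableSet_ball, inter_eq_left.2 hsub,
    hμ x hx s hs (by linarith), ENNReal.toReal_ofReal]
  have := ubv_nonneg k
  positivity

lemma hker_const (n k : ℕ) (μ : Measure (Eu n)) (hμ : LocUniform n k μ)
    (h0 : (0 : Eu n) ∈ msupp μ) (r : ℝ) (hr0 : 0 < r) (hr : r < 1 / 2)
    (x : Eu n) (hx : x ∈ msupp μ) (hx1 : ‖x‖ < 1 / 2) :
    ∫ y, hker r y x ∂(μ.restrict (ball (0 : Eu n) 1)) =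
      ∫ t in Ioi (0 : ℝ), if t < r ^ 4 then unitBallVol k * (√(r ^ 2 - √t)) ^ k else 0 := by
  have := fin_ball n k μ hμ h0
  have hi : Integrable (fun y => hker r y x) (μ.restrict (ball (0 : Eu n) 1)) :=
    Integrable.of_bound (hker_cont r x).aestronglyMeasurable ((r ^ 2) ^ 2)
      (ae_of_all _ fun y => hker_bd r x y)
  rw [hi.integral_eq_integral_meas_lt (ae_of_all _ fun y => by simp only [hker, Pi.zero_apply]; positivity)]
  apply setIntegral_congr_fun measurableSet_Ioi
  intro t ht
  have ht : 0 < t := ht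
  simp only
  have hst : √t ^ 2 = t := Real.sq_sqrt ht.le
  have hst0 : 0 < √t := Real.sqrt_pos.2 ht
  split_ifs with h
  · have h1 : √t < r ^ 2 := by
      rw [Real.sqrt_lt' (by positivity)]; nlinarith
    have h2 : √(r ^ 2 - √t) ^ 2 = r ^ 2 - √t := Real.sq_sqrt (by linarith)
    have h3 : 0 < √(r ^ 2 - √t) := Real.sqrt_pos.2 (by linarith)
    rw [← ball_real n k μ hμ x hx hx1 _ h3 (by nlinarith)]
    congr 1
    ext y
    rw [mem_ofPred_eq, mem_ball, dist_eq_norm, hker, Real.lt_sqrt (norm_nonneg _)]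
    constructor
    · intro h
      rw [← hst] at h
      have := lt_of_pow_lt_pow_left₀ 2 (le_max_left _ _) h
      rcases lt_max_iff.1 this with h | h <;> linarith
    · intro h
      have h5 : √t < max 0 (r ^ 2 - ‖y - x‖ ^ 2) := lt_max_of_lt_right (by linarith)
      calc t = √t ^ 2 := hst.symm
        _ < _ := pow_lt_pow_left₀ h5 hst0.le (by norm_num)
  · have : {y : Eu n | t < hker r y x} = ∅ := by
      ext y
      simp only [mem_ofPred_eq, mem_empty_iff_false, iff_false, not_lt]
      have := (le_abs_self _).trans (hker_bd r x y)
      nlinarith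
    rw [this, measureReal_empty]

lemma A_val (n k : ℕ) (μ : Measure (Eu n)) (hμ : LocUniform n k μ)
    (h0 : (0 : Eu n) ∈ msupp μ) (r : ℝ) (hr0 : 0 < r) (hr : r < 1 / 2) :
    ∫ y in ball (0 : Eu n) r, (r ^ 2 - ‖y‖ ^ 2) ∂μ =
      unitBallVol k * r ^ (k + 2) * (2 / (k + 2)) := by
  have := fin_ball n k μ hμ h0
  have e1 : ∫ y in ball (0 : Eu n) r, (r ^ 2 - ‖y‖ ^ 2) ∂μ =
      ∫ y, max 0 (r ^ 2 - ‖y‖ ^ 2) ∂(μ.restrict (ball (0 : Eu n) 1)) := by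
    have hsub : ball (0 : Eu n) r ⊆ ball 0 1 := ball_subset_ball (by linarith)
    rw [← integral_indicator measurableSet_ball, ← integral_indicator measurableSet_ball]
    congr 1
    ext y
    by_cases hy : y ∈ ball (0 : Eu n) r
    · rw [indicator_of_mem hy, indicator_of_mem (hsub hy), max_eq_right]
      rw [mem_ball_zero_iff] at hy
      nlinarith [norm_nonneg y]
    · rw [indicator_of_notMem hy]
      rw [mem_ball_zero_iff, not_lt] at hy
      have : max 0 (r ^ 2 - ‖y‖ ^ 2) = 0 := max_eq_left (by nlinarith)
      simp [indicator, this]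
  have hc : Continuous (fun y : Eu n => max 0 (r ^ 2 - ‖y‖ ^ 2)) := by fun_prop
  have hi : Integrable (fun y : Eu n => max 0 (r ^ 2 - ‖y‖ ^ 2)) (μ.restrict (ball (0 : Eu n) 1)) :=
    Integrable.of_bound hc.aestronglyMeasurable (r ^ 2)
      (ae_of_all _ fun y => by
        rw [Real.norm_of_nonneg (le_max_left _ _)]
        exact max_le (by positivity) (by nlinarith [norm_nonneg y]))
  rw [e1, hi.integral_eq_integral_meas_lt (ae_of_all _ fun y => le_max_left _ _)]
  have e2 : ∀ t ∈ Ioi (0 : ℝ), (μ.restrict (ball (0 : Eu n) 1)).real {y : Eu n | t < max 0 (r ^ 2 - ‖y‖ ^ 2)} =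
      (Ioo 0 (r ^ 2)).indicator (fun t => unitBallVol k * (r ^ 2 - t) ^ ((k : ℝ) / 2)) t := by
    intro t ht
    have ht : 0 < t := ht
    by_cases h : t < r ^ 2
    · rw [indicator_of_mem (show t ∈ Ioo 0 (r ^ 2) from ⟨ht, h⟩)]
      have h2 : √(r ^ 2 - t) ^ 2 = r ^ 2 - t := Real.sq_sqrt (by linarith)
      have h3 : 0 < √(r ^ 2 - t) := Real.sqrt_pos.2 (by linarith)
      have h4 : (r ^ 2 - t) ^ ((k : ℝ) / 2) = √(r ^ 2 - t) ^ k := by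
        rw [Real.sqrt_eq_rpow, ← Real.rpow_natCast (_ ^ (1 / 2 : ℝ)), ← Real.rpow_mul (by linarith)]
        congr 1; ring
      rw [h4, ← ball_real n k μ hμ 0 h0 (by simp) _ h3 (by nlinarith)]
      congr 1
      ext y
      simp only [mem_ofPred_eq, mem_ball_zero_iff, lt_max_iff]
      rw [Real.lt_sqrt (norm_nonneg _)]
      constructor
      · rintro (h | h) <;> linarith
      · intro h; right; linarith
    · have : {y : Eu n | t < max 0 (r ^ 2 - ‖y‖ ^ 2)} = ∅ := by
        ext y
        simp only [mem_ofPred_eq, mem_empty_iff_false, iff_false, not_lt]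
        exact max_le ht.le (by nlinarith [norm_nonneg y])
      rw [this, measureReal_empty]
      rw [indicator_of_notMem]
      exact fun h' => h h'.2
  rw [setIntegral_congr_fun measurableSet_Ioi e2, setIntegral_indicator measurableSet_Ioo]
  have e3 : Ioi (0:ℝ) ∩ Ioo 0 (r ^ 2) = Ioo 0 (r ^ 2) := inter_eq_right.2 fun t ht => ht.1
  rw [e3, ← integral_Ioc_eq_integral_Ioo, ← intervalIntegral.integral_of_le (by positivity),
    intervalIntegral.integral_const_mul,
    intervalIntegral.integral_comp_sub_left (fun t => t ^ ((k : ℝ) / 2)) (r ^ 2),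
    integral_rpow (Or.inl (by have : (0:ℝ) ≤ k / 2 := by positivity
                              linarith))]
  have h5 : (k : ℝ) / 2 + 1 ≠ 0 := by positivity
  rw [sub_self, sub_zero, Real.zero_rpow h5]
  have h6 : (r ^ 2) ^ ((k : ℝ) / 2 + 1) = r ^ (k + 2) := by
    rw [← Real.rpow_natCast, ← Real.rpow_mul hr0.le, ← Real.rpow_natCast]
    congr 1; push_cast; ring
  rw [h6]
  field_simp
  ring

lemma sphere_null (n k : ℕ) (μ : Measure (Eu n)) (hμ : LocUniform n k μ)
    (h0 : (0 : Eu n) ∈ msupp μ) (r : ℝ) (hr0 : 0 < r) (hr : r < 1 / 2) :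
    ∀ᵐ y ∂(μ.restrict (ball (0 : Eu n) 1)), ‖y‖ ≠ r := by
  have := fin_ball n k μ hμ h0
  set ν := μ.restrict (ball (0 : Eu n) 1)
  have hle : ∀ s, r < s → s < 1 / 2 → ν.real (sphere (0 : Eu n) r) ≤ unitBallVol k * s ^ k - unitBallVol k * r ^ k := by
    intro s hs hs1
    rw [← ball_real n k μ hμ 0 h0 (by simp) s (by linarith) hs1,
      ← ball_real n k μ hμ 0 h0 (by simp) r (by linarith) hr, le_sub_iff_add_le,
      ← measureReal_union _ measurableSet_ball]
    · apply measureReal_mono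
      rintro y (hy | hy)
      · simp at hy ⊢; linarith
      · simp at hy ⊢; linarith
      · finiteness
    · rw [Set.disjoint_left]; intro y hy; simp at hy ⊢; linarith
  have hz : ν.real (sphere (0 : Eu n) r) ≤ 0 := by
    have ht : Tendsto (fun s : ℝ => unitBallVol k * s ^ k - unitBallVol k * r ^ k) (𝓝[>] r) (𝓝 0) := by
      have : Continuous (fun s : ℝ => unitBallVol k * s ^ k - unitBallVol k * r ^ k) := by fun_prop
      have := (this.tendsto r).mono_left (nhdsWithin_le_nhds (s := Ioi r))
      simpa using this
    apply ge_of_tendsto ht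
    filter_upwards [Ioo_mem_nhdsGT hr] with s hs
    exact hle s hs.1 hs.2
  have hz' : ν.real (sphere (0 : Eu n) r) = 0 := le_antisymm hz measureReal_nonneg
  rw [measureReal_eq_zero_iff] at hz'
  rw [ae_iff]
  convert hz' using 2
  ext y; simp

lemma tendsto_second {k : ℕ} (f : EuclideanSpace ℝ (Fin k) → ℝ) (hf : ContDiff ℝ 2 f)
    (h0 : f 0 = 0) (hd : fderiv ℝ f 0 = 0) (v : EuclideanSpace ℝ (Fin k)) :
    Tendsto (fun t : ℝ => f (t • v) / t ^ 2) (𝓝[≠] 0)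
      (𝓝 (fderiv ℝ (fun x => fderiv ℝ f x v) 0 v / 2)) := by
  have hdf : Differentiable ℝ f := hf.differentiable (by norm_num)
  have hd2 : Differentiable ℝ (fun x => fderiv ℝ f x v) := by
    have : ContDiff ℝ 1 (fderiv ℝ f) := hf.fderiv_right (by norm_num)
    exact (this.differentiable (by norm_num)).clm_apply (differentiable_const v)
  have hl : ∀ t : ℝ, HasDerivAt (fun t : ℝ => t • v) v t := fun t => by
    simpa using (hasDerivAt_id t).smul_const v
  have h1 : ∀ t : ℝ, HasDerivAt (fun t : ℝ => f (t • v)) (fderiv ℝ f (t • v) v) t := fun t =>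
    (hdf (t • v)).hasFDerivAt.comp_hasDerivAt t (hl t)
  have h2 : HasDerivAt (fun t : ℝ => fderiv ℝ f (t • v) v)
      (fderiv ℝ (fun x => fderiv ℝ f x v) 0 v) 0 := by
    have := (hd2 ((0:ℝ) • v)).hasFDerivAt.comp_hasDerivAt (0:ℝ) (hl 0)
    simp only [zero_smul] at this
    exact this
  apply HasDerivAt.lhopital_zero_nhdsNE (f' := fun t => fderiv ℝ f (t • v) v) (g' := fun t => 2 * t)
  · exact Eventually.of_forall h1
  · exact Eventually.of_forall fun t => by simpa using hasDerivAt_pow 2 t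
  · filter_upwards [self_mem_nhdsWithin] with t ht
    have : t ≠ 0 := ht
    positivity
  · have := (h1 0).continuousAt.tendsto.mono_left (nhdsWithin_le_nhds (s := {(0:ℝ)}ᶜ))
    simpa [h0] using this
  · have : Continuous (fun t : ℝ => t ^ 2) := by fun_prop
    have := (this.tendsto 0).mono_left (nhdsWithin_le_nhds (s := {(0:ℝ)}ᶜ))
    simpa using this
  · rw [hasDerivAt_iff_tendsto_slope] at h2
    have := h2.div_const 2
    refine this.congr fun t => ?_
    simp [slope_def_field, hd]
    ring

/-- curve on the graph -/
def crv (n k : ℕ) (φ : Fin (n + 1) → EuclideanSpace ℝ (Fin k) → ℝ) (i : Fin k) (t : ℝ) : Eu n :=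
  graphMap n k φ (t • EuclideanSpace.single i 1)

/-- second derivative vector -/
def cvec (n k : ℕ) (φ : Fin (n + 1) → EuclideanSpace ℝ (Fin k) → ℝ) (i : Fin k) : Eu n :=
  WithLp.toLp 2 (fun j => if k ≤ (j : ℕ) then fderiv ℝ (fun x => fderiv ℝ (φ j) x (EuclideanSpace.single i 1)) 0
    (EuclideanSpace.single i 1) else 0)

lemma crv_apply (n k : ℕ) (φ : Fin (n + 1) → EuclideanSpace ℝ (Fin k) → ℝ) (i : Fin k) (t : ℝ)
    (j : Fin (n + 1)) : crv n k φ i t j =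
      if h : (j : ℕ) < k then (if (j : ℕ) = i then t else 0) else φ j (t • EuclideanSpace.single i 1) := by
  simp only [crv, graphMap]
  change (if h : (j : ℕ) < k then _ else _) = _
  split_ifs with h1 h2
  · simp [PiLp.single_apply, Fin.ext_iff, h2]
  · simp [PiLp.single_apply, Fin.ext_iff, h2]
  · rfl

lemma tendsto_eu {n : ℕ} {f : ℝ → Eu n} {l : Filter ℝ} {c : Eu n}
    (h : ∀ j, Tendsto (fun t => f t j) l (𝓝 (c j))) : Tendsto f l (𝓝 c) := by
  have h1 : Tendsto (fun t => (f t).ofLp) l (𝓝 c.ofLp) := tendsto_pi_nhds.2 h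
  exact ((PiLp.continuous_toLp 2 (fun _ : Fin (n+1) => ℝ)).tendsto _).comp h1

lemma tendsto_neg_ne : Tendsto (fun t : ℝ => -t) (𝓝[≠] 0) (𝓝[≠] 0) := by
  rw [tendsto_nhdsWithin_iff]
  constructor
  · have := (continuous_neg (G := ℝ)).tendsto 0
    rw [neg_zero] at this
    exact this.mono_left nhdsWithin_le_nhds
  · filter_upwards [self_mem_nhdsWithin] with t ht
    simpa using ht

lemma crv_V (n k : ℕ) (φ : Fin (n + 1) → EuclideanSpace ℝ (Fin k) → ℝ) (i : Fin k)
    (hφC2 : ∀ j : Fin (n + 1), k ≤ (j : ℕ) → ContDiff ℝ 2 (φ j))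
    (hφ0 : ∀ j : Fin (n + 1), k ≤ (j : ℕ) → φ j 0 = 0)
    (hφd : ∀ j : Fin (n + 1), k ≤ (j : ℕ) → fderiv ℝ (φ j) 0 = 0) :
    Tendsto (fun t : ℝ => (t ^ 2)⁻¹ • (crv n k φ i t + crv n k φ i (-t))) (𝓝[≠] 0)
      (𝓝 (cvec n k φ i)) := by
  apply tendsto_eu
  intro j
  simp only [PiLp.smul_apply, PiLp.add_apply, crv_apply, cvec, smul_eq_mul]
  by_cases h : (j : ℕ) < k
  · have h' : ¬ k ≤ (j : ℕ) := by omega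
    simp only [h, h', dite_true, if_false]
    refine tendsto_const_nhds.congr fun t => ?_
    split_ifs <;> simp
  · have h' : k ≤ (j : ℕ) := by omega
    simp only [h, h', dite_false, if_true]
    have h1 := tendsto_second (φ j) (hφC2 j h') (hφ0 j h') (hφd j h') (EuclideanSpace.single i 1)
    have h2 := h1.add (h1.comp tendsto_neg_ne)
    rw [add_halves] at h2
    refine h2.congr fun t => ?_
    simp only [Function.comp, neg_sq]
    ring

lemma crv_W (n k : ℕ) (hk : k ≤ n + 1) (φ : Fin (n + 1) → EuclideanSpace ℝ (Fin k) → ℝ) (i : Fin k)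
    (hφC2 : ∀ j : Fin (n + 1), k ≤ (j : ℕ) → ContDiff ℝ 2 (φ j))
    (hφ0 : ∀ j : Fin (n + 1), k ≤ (j : ℕ) → φ j 0 = 0)
    (hφd : ∀ j : Fin (n + 1), k ≤ (j : ℕ) → fderiv ℝ (φ j) 0 = 0) :
    Tendsto (fun t : ℝ => t⁻¹ • crv n k φ i t) (𝓝[≠] 0)
      (𝓝 (EuclideanSpace.single (Fin.castLE hk i) 1)) := by
  apply tendsto_eu
  intro j
  simp only [PiLp.smul_apply, crv_apply, smul_eq_mul, PiLp.single_apply, Fin.ext_iff,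
    Fin.val_castLE]
  by_cases h : (j : ℕ) < k
  · simp only [h, dite_true]
    refine tendsto_const_nhds.congr' ?_
    filter_upwards [self_mem_nhdsWithin] with t ht
    have : t ≠ 0 := ht
    split_ifs <;> simp [this]
  · have h' : k ≤ (j : ℕ) := by omega
    have h'' : ¬ (j : ℕ) = i := by omega
    simp only [h, h'', dite_false, if_false]
    have h1 := tendsto_second (φ j) (hφC2 j h') (hφ0 j h') (hφd j h') (EuclideanSpace.single i 1)
    have h3 : Tendsto (fun t : ℝ => t) (𝓝[≠] 0) (𝓝 0) := tendsto_id.mono_left nhdsWithin_le_nhds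
    have h2 := h1.mul h3
    rw [mul_zero] at h2
    refine h2.congr' ?_
    filter_upwards [self_mem_nhdsWithin] with t ht
    have : t ≠ 0 := ht
    field_simp

lemma p_expand {n : ℕ} (r : ℝ) (y x : Eu n) :
    hker r y x = (max 0 ((r ^ 2 - ‖y‖ ^ 2) + (2 * ⟪x, y⟫ - ‖x‖ ^ 2))) ^ 2 := by
  rw [hker, norm_sub_sq_real, real_inner_comm]
  congr 2; ring

/-- second difference, pointwise facts -/
lemma D_bound {n : ℕ} (r : ℝ) (hr0 : 0 < r) (hr : r < 1 / 2) (y x x' : Eu n) (t M : ℝ) (ht : t ≠ 0)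
    (ht1 : |t| ≤ 1) (hM : 0 ≤ M) (hy : ‖y‖ ≤ 1)
    (h1 : ‖(t ^ 2)⁻¹ • (x + x')‖ ≤ M) (h2 : ‖t⁻¹ • x‖ ≤ 2) (h3 : ‖t⁻¹ • x'‖ ≤ 2) :
    ‖(t ^ 2)⁻¹ * (hker r y x + hker r y x' - 2 * hker r y 0)‖ ≤ 2 * (2 * M + 8) + 128 := by
  have ht2 : 0 < t ^ 2 := by positivity
  have hta : 0 < |t| := abs_pos.2 ht
  have hts : |t| ^ 2 = t ^ 2 := sq_abs t
  rw [norm_smul, norm_inv, Real.norm_eq_abs, abs_of_pos ht2, inv_mul_le_iff₀ ht2] at h1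
  rw [norm_smul, norm_inv, Real.norm_eq_abs, inv_mul_le_iff₀ hta] at h2 h3
  have b1 : |⟪x + x', y⟫| ≤ t ^ 2 * M := (abs_real_inner_le_norm _ _).trans
    ((mul_le_of_le_one_right (norm_nonneg _) hy).trans h1)
  have b2 : |⟪x, y⟫| ≤ |t| * 2 := (abs_real_inner_le_norm _ _).trans
    ((mul_le_of_le_one_right (norm_nonneg _) hy).trans h2)
  have b3 : |⟪x', y⟫| ≤ |t| * 2 := (abs_real_inner_le_norm _ _).trans
    ((mul_le_of_le_one_right (norm_nonneg _) hy).trans h3)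
  have n2 : ‖x‖ ^ 2 ≤ 4 * t ^ 2 := by nlinarith [norm_nonneg x]
  have n3 : ‖x'‖ ^ 2 ≤ 4 * t ^ 2 := by nlinarith [norm_nonneg x']
  have hq : t ^ 2 ≤ |t| := by nlinarith
  have hp : ∀ z : Eu n, |⟪z, y⟫| ≤ |t| * 2 → ‖z‖ ^ 2 ≤ 4 * t ^ 2 →
      (2 * ⟪z, y⟫ - ‖z‖ ^ 2) ^ 2 ≤ 64 * t ^ 2 := by
    intro z hz hz2
    rw [abs_le] at hz
    have : |2 * ⟪z, y⟫ - ‖z‖ ^ 2| ≤ 8 * |t| := by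
      rw [abs_le]; constructor <;> linarith [sq_nonneg ‖z‖]
    have := pow_le_pow_left₀ (abs_nonneg _) this 2
    rw [sq_abs, mul_pow, hts] at this
    linarith
  have p2 := hp x b2 n2
  have p3 := hp x' b3 n3
  rw [p_expand r y x, p_expand r y x', p_expand r y 0]
  rw [inner_add_left] at b1
  simp only [inner_zero_left, norm_zero]
  have e0 : (r ^ 2 - ‖y‖ ^ 2) + (2 * 0 - 0 ^ 2) = (r ^ 2 - ‖y‖ ^ 2) := by ring
  rw [e0]
  set a := r ^ 2 - ‖y‖ ^ 2 with ha
  set p := 2 * ⟪x, y⟫ - ‖x‖ ^ 2 with hpd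
  set p' := 2 * ⟪x', y⟫ - ‖x'‖ ^ 2 with hpd'
  have g1 := aux_g a p
  have g2 := aux_g a p'
  have ha1 : max 0 a ≤ 1 := max_le zero_le_one (by nlinarith [norm_nonneg y])
  have ha0 : 0 ≤ max 0 a := le_max_left _ _
  have hpp : |p + p'| ≤ t ^ 2 * (2 * M + 8) := by
    rw [abs_le] at b1 ⊢
    constructor <;> linarith [sq_nonneg ‖x‖, sq_nonneg ‖x'‖]
  have hm : |max 0 a * (p + p')| ≤ t ^ 2 * (2 * M + 8) := by
    rw [abs_mul, abs_of_nonneg ha0]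
    exact (mul_le_of_le_one_left (abs_nonneg _) ha1).trans hpp
  rw [norm_mul, norm_inv, Real.norm_eq_abs, abs_of_pos ht2, inv_mul_le_iff₀ ht2, Real.norm_eq_abs]
  rw [abs_le] at g1 g2 hm ⊢
  constructor <;> linarith

lemma D_lim {n : ℕ} (r : ℝ) (hr0 : 0 < r) (y c d : Eu n) (hd : ‖d‖ = 1) (hy : ‖y‖ ≠ r) (X : ℝ → Eu n)
    (hV : Tendsto (fun t : ℝ => (t ^ 2)⁻¹ • (X t + X (-t))) (𝓝[≠] 0) (𝓝 c))
    (hW : Tendsto (fun t : ℝ => t⁻¹ • X t) (𝓝[≠] 0) (𝓝 d)) :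
    Tendsto (fun t : ℝ => (t ^ 2)⁻¹ * (hker r y (X t) + hker r y (X (-t)) - 2 * hker r y 0)) (𝓝[≠] 0)
      (𝓝 ((ball (0 : Eu n) r).indicator
        (fun y => 4 * ((r ^ 2 - ‖y‖ ^ 2) * ⟪c, y⟫) - 4 * (r ^ 2 - ‖y‖ ^ 2) + 8 * ⟪d, y⟫ ^ 2) y)) := by
  have hid : Tendsto (fun t : ℝ => t) (𝓝[≠] 0) (𝓝 0) := tendsto_id.mono_left nhdsWithin_le_nhds
  have hX : Tendsto X (𝓝[≠] 0) (𝓝 0) := by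
    have := hid.smul hW
    rw [zero_smul] at this
    refine this.congr' ?_
    filter_upwards [self_mem_nhdsWithin] with t ht
    have : t ≠ 0 := ht
    rw [smul_inv_smul₀ this]
  have hX' := hX.comp tendsto_neg_ne
  have hW' := hW.comp tendsto_neg_ne
  have hn : Tendsto (fun t => r ^ 2 - ‖y - X t‖ ^ 2) (𝓝[≠] 0) (𝓝 (r ^ 2 - ‖y‖ ^ 2)) := by
    have := ((tendsto_const_nhds (x := y)).sub hX).norm.pow 2
    rw [sub_zero] at this
    exact tendsto_const_nhds.sub this
  have hn' := hn.comp tendsto_neg_ne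
  rcases lt_or_gt_of_ne hy with h | h
  · have ha : 0 < r ^ 2 - ‖y‖ ^ 2 := by nlinarith [norm_nonneg y]
    rw [indicator_of_mem (by simpa using h)]
    have hp : ∀ {Z : ℝ → Eu n}, Tendsto Z (𝓝[≠] 0) (𝓝 d) →
      Tendsto (fun t : ℝ => (2 * ⟪Z t, y⟫ - t * ‖Z t‖ ^ 2) ^ 2) (𝓝[≠] 0) (𝓝 ((2 * ⟪d, y⟫ - 0 * ‖d‖ ^ 2) ^ 2)) :=
      fun hZ => (((hZ.inner tendsto_const_nhds).const_mul 2).sub (hid.mul (hZ.norm.pow 2))).pow 2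
    have hp1 := hp hW
    have hp2 := hp1.comp tendsto_neg_ne
    have hp3 := (((hV.inner (tendsto_const_nhds (x := y))).const_mul 2).sub (hW.norm.pow 2)).sub (hW'.norm.pow 2)
    have hall := ((hp3.const_mul (2 * (r ^ 2 - ‖y‖ ^ 2))).add hp1).add hp2
    rw [hd] at hall
    refine (hall.congr' ?_).trans (le_of_eq ?_)
    · filter_upwards [self_mem_nhdsWithin, hn.eventually (lt_mem_nhds ha), hn'.eventually (lt_mem_nhds ha)] with t ht h1 h2
      have ht : t ≠ 0 := ht
      simp only [Function.comp] at h2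
      simp only [hker, sub_zero, max_eq_right h1.le, max_eq_right h2.le, max_eq_right ha.le, Function.comp]
      rw [norm_sub_sq_real, norm_sub_sq_real, real_inner_comm (X t) y, real_inner_comm (X (-t)) y]
      simp only [norm_smul, real_inner_smul_left, inner_add_left, norm_inv, mul_pow, inv_pow, norm_neg, Real.norm_eq_abs, sq_abs]
      field_simp
      ring
    · congr 1; ring
  · have ha : r ^ 2 - ‖y‖ ^ 2 < 0 := by nlinarith [norm_nonneg y]
    rw [indicator_of_notMem (by simpa using h.le)]
    refine tendsto_const_nhds.congr' ?_
    filter_upwards [hn.eventually (gt_mem_nhds ha), hn'.eventually (gt_mem_nhds ha)] with t h1 h2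
    simp only [Function.comp] at h2
    simp [hker, max_eq_left h1.le, max_eq_left h2.le, max_eq_left ha.le]

lemma key_i (n k : ℕ) (hk : k ≤ n + 1) (μ : Measure (Eu n))
    (hμ : LocUniform n k μ) (h0 : (0 : Eu n) ∈ msupp μ)
    (r r₀ : ℝ) (hr0 : 0 < r) (hr : r < 1 / 2) (hr₀ : 0 < r₀)
    (φ : Fin (n + 1) → EuclideanSpace ℝ (Fin k) → ℝ)
    (hφC2 : ∀ j : Fin (n + 1), k ≤ (j : ℕ) → ContDiff ℝ 2 (φ j))
    (hφ0 : ∀ j : Fin (n + 1), k ≤ (j : ℕ) → φ j 0 = 0)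
    (hφd : ∀ j : Fin (n + 1), k ≤ (j : ℕ) → fderiv ℝ (φ j) 0 = 0)
    (hgraph : msupp μ ∩ ball (0 : Eu n) r₀ = Set.range (graphMap n k φ) ∩ ball (0 : Eu n) r₀)
    (i : Fin k) :
    ∫ y in ball (0 : Eu n) r, (4 * ((r ^ 2 - ‖y‖ ^ 2) * ⟪cvec n k φ i, y⟫) - 4 * (r ^ 2 - ‖y‖ ^ 2)
      + 8 * ⟪(EuclideanSpace.single (Fin.castLE hk i) 1 : Eu n), y⟫ ^ 2) ∂μ = 0 := by
  have := fin_ball n k μ hμ h0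
  have hV := crv_V n k φ i hφC2 hφ0 hφd
  have hW := crv_W n k hk φ i hφC2 hφ0 hφd
  set X := crv n k φ i with hXdef
  set c := cvec n k φ i
  set d : Eu n := EuclideanSpace.single (Fin.castLE hk i) 1
  have hd : ‖d‖ = 1 := by simp [d]
  have hid : Tendsto (fun t : ℝ => t) (𝓝[≠] 0) (𝓝 0) := tendsto_id.mono_left nhdsWithin_le_nhds
  have hX : Tendsto X (𝓝[≠] 0) (𝓝 0) := by
    have := hid.smul hW
    rw [zero_smul] at this
    refine this.congr' ?_
    filter_upwards [self_mem_nhdsWithin] with t ht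
    have : t ≠ 0 := ht
    rw [smul_inv_smul₀ this]
  have hgood : ∀ᶠ t in 𝓝[≠] (0 : ℝ), X t ∈ msupp μ ∧ ‖X t‖ < 1 / 2 := by
    filter_upwards [hX.eventually (ball_mem_nhds 0 hr₀),
      hX.eventually (ball_mem_nhds 0 (show (0:ℝ) < 1 / 2 by norm_num))] with t h1 h2
    refine ⟨?_, by simpa using h2⟩
    have : X t ∈ msupp μ ∩ ball (0 : Eu n) r₀ := by
      rw [hgraph]; exact ⟨⟨_, rfl⟩, h1⟩
    exact this.1
  have hW2 : ∀ᶠ t in 𝓝[≠] (0 : ℝ), ‖t⁻¹ • X t‖ ≤ 2 := by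
    have := hW.norm
    rw [hd] at this
    filter_upwards [this.eventually (gt_mem_nhds (show (1:ℝ) < 2 by norm_num))] with t h using h.le
  have hV2 : ∀ᶠ t in 𝓝[≠] (0 : ℝ), ‖(t ^ 2)⁻¹ • (X t + X (-t))‖ ≤ ‖c‖ + 1 := by
    filter_upwards [hV.norm.eventually (gt_mem_nhds (show ‖c‖ < ‖c‖ + 1 by linarith))] with t h using h.le
  have ht1 : ∀ᶠ t in 𝓝[≠] (0 : ℝ), |t| ≤ 1 := by
    filter_upwards [hid.eventually (ball_mem_nhds 0 one_pos)] with t h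
    rw [dist_zero_right, Real.norm_eq_abs] at h
    exact h.le
  have hT := tendsto_integral_filter_of_dominated_convergence
    (μ := μ.restrict (ball (0 : Eu n) 1)) (l := 𝓝[≠] (0 : ℝ))
    (F := fun t y => (t ^ 2)⁻¹ * (hker r y (X t) + hker r y (X (-t)) - 2 * hker r y 0))
    (f := (ball (0 : Eu n) r).indicator
        (fun y => 4 * ((r ^ 2 - ‖y‖ ^ 2) * ⟪c, y⟫) - 4 * (r ^ 2 - ‖y‖ ^ 2) + 8 * ⟪d, y⟫ ^ 2))
    (fun _ => 2 * (2 * (‖c‖ + 1) + 8) + 128) ?_ ?_ (integrable_const _) ?_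
  · have hz : ∀ᶠ t in 𝓝[≠] (0 : ℝ), ∫ y, (t ^ 2)⁻¹ * (hker r y (X t) + hker r y (X (-t)) - 2 * hker r y 0)
        ∂(μ.restrict (ball (0 : Eu n) 1)) = 0 := by
      filter_upwards [hgood, tendsto_neg_ne.eventually hgood] with t h1 h2
      have hi : ∀ x : Eu n, Integrable (fun y => hker r y x) (μ.restrict (ball (0 : Eu n) 1)) := fun x =>
        Integrable.of_bound (hker_cont r x).aestronglyMeasurable ((r ^ 2) ^ 2)
          (ae_of_all _ fun y => hker_bd r x y)
      rw [integral_const_mul, integral_sub (f := fun y => hker r y (X t) + hker r y (X (-t))) ((hi _).add (hi _)) ((hi _).const_mul 2), integral_add (hi _) (hi _),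
        integral_const_mul, hker_const n k μ hμ h0 r hr0 hr _ h1.1 h1.2,
        hker_const n k μ hμ h0 r hr0 hr _ h2.1 h2.2,
        hker_const n k μ hμ h0 r hr0 hr 0 h0 (by simp)]
      ring
    have hT0 := tendsto_nhds_unique hT (tendsto_const_nhds.congr' (hz.mono fun t h => h.symm))
    rw [integral_indicator measurableSet_ball, Measure.restrict_restrict measurableSet_ball,
      inter_eq_left.2 (ball_subset_ball (by linarith))] at hT0
    exact hT0
  · refine Eventually.of_forall fun t => Continuous.aestronglyMeasurable ?_
    have := hker_cont r (X t)
    have := hker_cont r (X (-t))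
    have := hker_cont r (0 : Eu n)
    fun_prop
  · filter_upwards [self_mem_nhdsWithin, hV2, hW2, tendsto_neg_ne.eventually hW2, ht1] with t h1 h2 h3 h4 h5
    filter_upwards [ae_restrict_mem measurableSet_ball] with y hy
    refine D_bound r hr0 hr y (X t) (X (-t)) t (‖c‖ + 1) h1 h5 (by positivity) ?_ h2 h3 ?_
    · exact (mem_ball_zero_iff.1 hy).le
    · rwa [inv_neg, neg_smul, norm_neg] at h4
  · filter_upwards [sphere_null n k μ hμ h0 r hr0 hr] with y hy
    exact D_lim r hr0 y c d hd hy X hV hW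

/-- Key equality:
`(1/2) Σ_{j≥k} b̃_j Δφ_j(0) = Σ_{j≥k} ∫_{B(0,r)} y_j² dμ(y)`. -/
theorem stmt4 (n k : ℕ) (hk : k ≤ n + 1) (μ : Measure (Eu n)) [IsLocallyFiniteMeasure μ]
    (hμ : LocUniform n k μ) (h0 : (0 : Eu n) ∈ msupp μ)
    (r r₀ : ℝ) (hr0 : 0 < r) (hr : r < 1 / 2) (hr₀ : 0 < r₀)
    (φ : Fin (n + 1) → EuclideanSpace ℝ (Fin k) → ℝ)
    (hφC2 : ∀ j : Fin (n + 1), k ≤ (j : ℕ) → ContDiff ℝ 2 (φ j))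
    (hφ0 : ∀ j : Fin (n + 1), k ≤ (j : ℕ) → φ j 0 = 0)
    (hφd : ∀ j : Fin (n + 1), k ≤ (j : ℕ) → fderiv ℝ (φ j) 0 = 0)
    (hgraph : msupp μ ∩ ball (0 : Eu n) r₀ = Set.range (graphMap n k φ) ∩ ball (0 : Eu n) r₀) :
    (1 / 2) * ∑ j ∈ Finset.univ.filter (fun j : Fin (n + 1) => k ≤ (j : ℕ)),
        (∫ y in ball (0 : Eu n) r, (r ^ 2 - ‖y‖ ^ 2) * y j ∂μ) * lap0 k (φ j)
      = ∑ j ∈ Finset.univ.filter (fun j : Fin (n + 1) => k ≤ (j : ℕ)),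
        ∫ y in ball (0 : Eu n) r, (y j) ^ 2 ∂μ := by
  have hfin := fin_ball n k μ hμ h0
  have hsub : ball (0 : Eu n) r ⊆ ball 0 1 := ball_subset_ball (by linarith)
  have hfr : IsFiniteMeasure (μ.restrict (ball (0 : Eu n) r)) := by
    constructor
    rw [Measure.restrict_apply_univ, hμ 0 h0 r hr0 (by linarith)]
    exact ENNReal.ofReal_lt_top
  -- integrability of continuous functions on the ball
  have hint : ∀ f : Eu n → ℝ, Continuous f → Integrable f (μ.restrict (ball (0 : Eu n) r)) := by
    intro f hf
    obtain ⟨C, hC⟩ := (isCompact_closedBall (0 : Eu n) r).exists_bound_of_continuousOn hf.continuousOn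
    refine Integrable.of_bound hf.aestronglyMeasurable C ?_
    filter_upwards [ae_restrict_mem measurableSet_ball] with y hy
    exact hC y (ball_subset_closedBall hy)
  have hA := A_val n k μ hμ h0 r hr0 hr
  set J := Finset.univ.filter (fun j : Fin (n + 1) => k ≤ (j : ℕ)) with hJ
  set A := ∫ y in ball (0 : Eu n) r, (r ^ 2 - ‖y‖ ^ 2) ∂μ with hAdef
  have hN : ∫ y in ball (0 : Eu n) r, ‖y‖ ^ 2 ∂μ = unitBallVol k * r ^ k * r ^ 2 - A := by
    have h1 : A = ∫ y in ball (0 : Eu n) r, r ^ 2 ∂μ - ∫ y in ball (0 : Eu n) r, ‖y‖ ^ 2 ∂μ :=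
      integral_sub (integrable_const _) (hint _ (by fun_prop))
    have h2 : μ.real (ball (0 : Eu n) r) = unitBallVol k * r ^ k := by
      rw [← ball_real n k μ hμ 0 h0 (by simp) r hr0 hr, measureReal_def, measureReal_def,
        Measure.restrict_apply measurableSet_ball, inter_eq_left.2 hsub]
    rw [setIntegral_const, h2, smul_eq_mul] at h1
    linarith
  have hkey : ∀ i : Fin k, ∑ j ∈ J, (∫ y in ball (0 : Eu n) r, (r ^ 2 - ‖y‖ ^ 2) * y j ∂μ) *
      fderiv ℝ (fun x => fderiv ℝ (φ j) x (EuclideanSpace.single i 1)) 0 (EuclideanSpace.single i 1)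
      - A + 2 * ∫ y in ball (0 : Eu n) r, (y (Fin.castLE hk i)) ^ 2 ∂μ = 0 := by
    intro i
    have h := key_i n k hk μ hμ h0 r r₀ hr0 hr hr₀ φ hφC2 hφ0 hφd hgraph i
    rw [integral_add (hint _ (by fun_prop)) (hint _ (by fun_prop)),
      integral_sub (hint _ (by fun_prop)) (hint _ (by fun_prop)), integral_const_mul,
      integral_const_mul, integral_const_mul] at h
    have h1 : ∫ y in ball (0 : Eu n) r, (r ^ 2 - ‖y‖ ^ 2) * ⟪cvec n k φ i, y⟫ ∂μ =
        ∑ j ∈ J, (∫ y in ball (0 : Eu n) r, (r ^ 2 - ‖y‖ ^ 2) * y j ∂μ) *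
      fderiv ℝ (fun x => fderiv ℝ (φ j) x (EuclideanSpace.single i 1)) 0 (EuclideanSpace.single i 1) := by
      simp_rw [← integral_mul_const]
      rw [← integral_finsetSum _ (fun j _ => hint _ (by fun_prop))]
      congr 1
      ext y
      rw [PiLp.inner_apply, Finset.mul_sum, hJ, Finset.sum_filter]
      refine Finset.sum_congr rfl fun j _ => ?_
      simp only [cvec]
      split_ifs <;> simp <;> ring
    have h2 : ∀ y : Eu n, ⟪(EuclideanSpace.single (Fin.castLE hk i) 1 : Eu n), y⟫ = y (Fin.castLE hk i) := by
      intro y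
      simp [EuclideanSpace.inner_single_left]
    simp_rw [h2] at h
    rw [h1, ← hAdef] at h
    linarith
  have hsum := Finset.sum_eq_zero (s := Finset.univ) (fun i _ => hkey i)
  rw [Finset.sum_add_distrib, Finset.sum_sub_distrib, Finset.sum_comm, Finset.sum_const,
    Finset.card_univ, Fintype.card_fin, nsmul_eq_mul, ← Finset.mul_sum] at hsum
  simp_rw [← Finset.mul_sum] at hsum
  have hsplit : ∫ y in ball (0 : Eu n) r, ‖y‖ ^ 2 ∂μ =
      (∑ i : Fin k, ∫ y in ball (0 : Eu n) r, (y (Fin.castLE hk i)) ^ 2 ∂μ) +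
      ∑ j ∈ J, ∫ y in ball (0 : Eu n) r, (y j) ^ 2 ∂μ := by
    simp_rw [EuclideanSpace.real_norm_sq_eq]
    rw [integral_finsetSum _ (fun j _ => hint _ (by fun_prop)),
      ← Finset.sum_filter_add_sum_filter_not Finset.univ (fun j : Fin (n + 1) => k ≤ (j : ℕ)), add_comm]
    congr 1
    symm
    apply Finset.sum_bij (fun (i : Fin k) _ => Fin.castLE hk i)
    · intro i _; simp
    · intro a _ b _ h; simpa using h
    · intro b hb
      simp at hb
      exact ⟨⟨b, hb⟩, Finset.mem_univ _, rfl⟩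
    · intro i _; rfl
  have hfinal : (k + 2) * A = 2 * (unitBallVol k * r ^ k * r ^ 2) := by
    rw [hA]; field_simp; ring
  simp only [lap0]
  linarith
end
end

section
/- (Strong unique continuation, local version) Let μ be a locally k-uniform measure in ℝ^{n+1} with 0 ∈ supp μ. Suppose supp μ near 0 is a C² graph over its tangent plane ℝ^k × {0}^{n+1−k} (with φ(0)=0, ∇φ(0)=0) and the mean curvature vector of supp μ vanishes at 0 (equivalently Δφ_j(0) = 0 for all j = k+1,…,n+1). Then for every 0 < r < 1/2, supp μ ∩ B(0,r) ⊆ ℝ^k × {0}^{n+1−k}. -/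
open MeasureTheory Metric Set Filter Module
open scoped RealInnerProductSpace Topology ENNReal

noncomputable section

def pp (a : ℝ) : ℝ := max (1 - a) 0

lemma pp_cont : Continuous pp := by unfold pp; fun_prop
lemma pp_nonneg (a : ℝ) : 0 ≤ pp a := le_max_right _ _
lemma pp_le_one {a : ℝ} (h : 0 ≤ a) : pp a ≤ 1 := by unfold pp; simp [h]
lemma pp_zero {a : ℝ} (h : 1 ≤ a) : pp a = 0 := by unfold pp; simp [h]

lemma pp_taylor (a δ : ℝ) :
    |pp (a + δ) ^ 3 - pp a ^ 3 + 3 * pp a ^ 2 * δ - 3 * pp a * δ ^ 2| ≤ |δ| ^ 3 := by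
  rw [← abs_pow]
  unfold pp
  rcases le_total a 1 with h1 | h1 <;> rcases le_total (a + δ) 1 with h2 | h2
  · rw [max_eq_left (by linarith), max_eq_left (by linarith)]
    rw [← abs_neg (δ ^ 3)]
    apply le_of_eq; congr 1; ring
  · rw [max_eq_right (by linarith : 1 - (a + δ) ≤ 0), max_eq_left (by linarith : 0 ≤ 1 - a)]
    have hd : 0 ≤ δ := by linarith
    have e : (0:ℝ) ^ 3 - (1 - a) ^ 3 + 3 * (1 - a) ^ 2 * δ - 3 * (1 - a) * δ ^ 2
      = (δ - (1 - a)) ^ 3 - δ ^ 3 := by ring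
    rw [e, abs_of_nonneg (pow_nonneg hd 3), abs_le]
    have h3 : 0 ≤ (δ - (1 - a)) ^ 3 := pow_nonneg (by linarith) 3
    have h4 : (δ - (1 - a)) ^ 3 ≤ δ ^ 3 := pow_le_pow_left₀ (by linarith) (by linarith) 3
    constructor <;> linarith [pow_nonneg hd 3]
  · rw [max_eq_left (by linarith : 0 ≤ 1 - (a + δ)), max_eq_right (by linarith : 1 - a ≤ 0)]
    have h4 : (1 - (a + δ)) ^ 3 ≤ (-δ) ^ 3 := pow_le_pow_left₀ (by linarith) (by linarith) 3
    have h3 : 0 ≤ (1 - (a + δ)) ^ 3 := pow_nonneg (by linarith) 3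
    have e : (-δ) ^ 3 = - δ ^ 3 := by ring
    ring_nf at h3 h4 e ⊢
    rw [abs_of_nonneg h3, abs_of_nonpos (by linarith)]
    linarith
  · rw [max_eq_right (by linarith), max_eq_right (by linarith)]
    simp

section gen
variable {E : Type*} [NormedAddCommGroup E] [InnerProductSpace ℝ E] [FiniteDimensional ℝ E]
  [MeasurableSpace E] [BorelSpace E]

def FF (ν : Measure E) (x : E) : ℝ := ∫ y, pp (‖y - x‖ ^ 2) ^ 3 ∂ν
def AA (ν : Measure E) : ℝ := ∫ y, pp (‖y‖ ^ 2) ^ 2 ∂ν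
def LL (ν : Measure E) (x : E) : ℝ := ∫ y, pp (‖y‖ ^ 2) ^ 2 * ⟪x, y⟫ ∂ν
def QQ (ν : Measure E) (x : E) : ℝ := ∫ y, pp (‖y‖ ^ 2) * ⟪x, y⟫ ^ 2 ∂ν

variable (ν : Measure E) [IsFiniteMeasure ν] (hν : ∀ᵐ y ∂ν, ‖y‖ ≤ 2)
include hν

lemma intble {f : E → ℝ} (hf : Continuous f) : Integrable f ν := by
  obtain ⟨C, hC⟩ := (isCompact_closedBall (0:E) 2).exists_bound_of_continuousOn hf.continuousOn
  refine Integrable.of_bound hf.aestronglyMeasurable C ?_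
  filter_upwards [hν] with y hy
  exact hC y (by simpa using hy)

omit [FiniteDimensional ℝ E] [MeasurableSpace E] [BorelSpace E] [IsFiniteMeasure ν] hν in
lemma ptwise (x y : E) (hx : ‖x‖ ≤ 1) (hy : ‖y‖ ≤ 2) :
    |pp (‖y - x‖ ^ 2) ^ 3 - pp (‖y‖ ^ 2) ^ 3 - (6 * (pp (‖y‖ ^ 2) ^ 2 * ⟪x, y⟫)
      - 3 * ‖x‖ ^ 2 * pp (‖y‖ ^ 2) ^ 2 + 12 * (pp (‖y‖ ^ 2) * ⟪x, y⟫ ^ 2))| ≤ 152 * ‖x‖ ^ 3 := by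
  have e : ‖y - x‖ ^ 2 = ‖y‖ ^ 2 + (‖x‖ ^ 2 - 2 * ⟪x, y⟫) := by
    rw [norm_sub_sq_real, real_inner_comm]; ring
  have T := pp_taylor (‖y‖ ^ 2) (‖x‖ ^ 2 - 2 * ⟪x, y⟫)
  rw [← e] at T
  have hi : |⟪x, y⟫| ≤ 2 * ‖x‖ := by
    have := abs_real_inner_le_norm x y
    nlinarith [norm_nonneg x]
  generalize pp (‖y - x‖ ^ 2) = P at *
  have hp0 := pp_nonneg (‖y‖ ^ 2)
  have hp1 := pp_le_one (sq_nonneg ‖y‖)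
  generalize pp (‖y‖ ^ 2) = p at *
  generalize (⟪x, y⟫ : ℝ) = s at *
  have hr := norm_nonneg x
  generalize ‖x‖ = r at *
  have hd : |r ^ 2 - 2 * s| ≤ 5 * r := by
    rw [abs_le] at hi ⊢
    constructor <;> nlinarith
  have hd3 : |r ^ 2 - 2 * s| ^ 3 ≤ 125 * r ^ 3 := by
    calc _ ≤ (5 * r) ^ 3 := pow_le_pow_left₀ (abs_nonneg _) hd 3
      _ = _ := by ring
  have h2 : |3 * p * (r ^ 4 - 4 * r ^ 2 * s)| ≤ 27 * r ^ 3 := by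
    rw [abs_mul, abs_of_nonneg (by positivity : 0 ≤ 3 * p)]
    have : |r ^ 4 - 4 * r ^ 2 * s| ≤ 9 * r ^ 3 := by
      have e1 : r ^ 4 ≤ r ^ 3 := pow_le_pow_of_le_one hr hx (by norm_num)
      have e0 : 0 ≤ r ^ 4 := by positivity
      have e2 : |r ^ 2 * s| ≤ 2 * r ^ 3 := by
        rw [abs_mul, abs_of_nonneg (sq_nonneg r)]
        nlinarith [sq_nonneg r]
      rw [abs_le] at e2 ⊢
      constructor <;> linarith
    calc 3 * p * |r ^ 4 - 4 * r ^ 2 * s| ≤ 3 * 1 * (9 * r ^ 3) := by gcongr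
      _ = _ := by ring
  have := abs_add_le (P ^ 3 - p ^ 3 + 3 * p ^ 2 * (r ^ 2 - 2 * s) - 3 * p * (r ^ 2 - 2 * s) ^ 2)
    (3 * p * (r ^ 4 - 4 * r ^ 2 * s))
  calc _ = _ := by congr 1; ring
    _ ≤ _ := this
    _ ≤ _ := by linarith

lemma expand (x : E) (hx : ‖x‖ ≤ 1) :
    |FF ν x - FF ν 0 - (6 * LL ν x - 3 * ‖x‖ ^ 2 * AA ν + 12 * QQ ν x)| ≤
      152 * ‖x‖ ^ 3 * ν.real univ := by
  have c := pp_cont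
  have i1 : Integrable (fun y : E => pp (‖y - x‖ ^ 2) ^ 3) ν := intble ν hν (by fun_prop)
  have i2 : Integrable (fun y : E => pp (‖y‖ ^ 2) ^ 3) ν := intble ν hν (by fun_prop)
  have i3 : Integrable (fun y : E => 6 * (pp (‖y‖ ^ 2) ^ 2 * ⟪x, y⟫)) ν := intble ν hν (by fun_prop)
  have i4 : Integrable (fun y : E => 3 * ‖x‖ ^ 2 * pp (‖y‖ ^ 2) ^ 2) ν := intble ν hν (by fun_prop)
  have i5 : Integrable (fun y : E => 12 * (pp (‖y‖ ^ 2) * ⟪x, y⟫ ^ 2)) ν :=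
    intble ν hν (by fun_prop)
  have e : FF ν x - FF ν 0 - (6 * LL ν x - 3 * ‖x‖ ^ 2 * AA ν + 12 * QQ ν x) =
     ∫ y, (pp (‖y - x‖ ^ 2) ^ 3 - pp (‖y‖ ^ 2) ^ 3 - (6 * (pp (‖y‖ ^ 2) ^ 2 * ⟪x, y⟫)
      - 3 * ‖x‖ ^ 2 * pp (‖y‖ ^ 2) ^ 2 + 12 * (pp (‖y‖ ^ 2) * ⟪x, y⟫ ^ 2))) ∂ν := by
    have i12 : Integrable (fun y : E => pp (‖y - x‖ ^ 2) ^ 3 - pp (‖y‖ ^ 2) ^ 3) ν := i1.sub i2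
    have i34 : Integrable (fun y : E => 6 * (pp (‖y‖ ^ 2) ^ 2 * ⟪x, y⟫) - 3 * ‖x‖ ^ 2 * pp (‖y‖ ^ 2) ^ 2) ν := i3.sub i4
    have i345 : Integrable (fun y : E => 6 * (pp (‖y‖ ^ 2) ^ 2 * ⟪x, y⟫) - 3 * ‖x‖ ^ 2 * pp (‖y‖ ^ 2) ^ 2 + 12 * (pp (‖y‖ ^ 2) * ⟪x, y⟫ ^ 2)) ν := i34.add i5
    rw [integral_sub i12 i345, integral_sub i1 i2,
      integral_add i34 i5, integral_sub i3 i4, integral_const_mul, integral_const_mul,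
      integral_const_mul]
    simp [FF, LL, AA, QQ]
  rw [e, ← Real.norm_eq_abs]
  apply norm_integral_le_of_norm_le_const
  filter_upwards [hν] with y hy
  exact ptwise x y hx hy

omit [FiniteDimensional ℝ E] in
lemma LL_cont : Continuous (LL ν) := by
  have c := pp_cont
  rw [continuous_iff_continuousAt]
  intro x₀
  apply continuousAt_of_dominated (bound := fun _ => (‖x₀‖ + 1) * 2)
  · exact .of_forall fun x => (by fun_prop : Continuous _).aestronglyMeasurable
  · filter_upwards [Metric.ball_mem_nhds x₀ one_pos] with x hx
    filter_upwards [hν] with y hy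
    have h1 : ‖x‖ ≤ ‖x₀‖ + 1 := by
      have := norm_le_norm_add_norm_sub' x x₀
      rw [mem_ball, dist_eq_norm] at hx; linarith
    rw [norm_mul, ← one_mul ((‖x₀‖ + 1) * 2)]
    gcongr
    · rw [Real.norm_eq_abs, abs_of_nonneg (by positivity)]
      exact pow_le_one₀ (pp_nonneg _) (pp_le_one (sq_nonneg _))
    · exact (norm_inner_le_norm x y).trans (by gcongr)
  · exact integrable_const _
  · exact .of_forall fun y => by fun_prop

omit [FiniteDimensional ℝ E] in
lemma QQ_cont : Continuous (QQ ν) := by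
  have c := pp_cont
  rw [continuous_iff_continuousAt]
  intro x₀
  apply continuousAt_of_dominated (bound := fun _ => ((‖x₀‖ + 1) * 2) ^ 2)
  · exact .of_forall fun x => (by fun_prop : Continuous _).aestronglyMeasurable
  · filter_upwards [Metric.ball_mem_nhds x₀ one_pos] with x hx
    filter_upwards [hν] with y hy
    have h1 : ‖x‖ ≤ ‖x₀‖ + 1 := by
      have := norm_le_norm_add_norm_sub' x x₀
      rw [mem_ball, dist_eq_norm] at hx; linarith
    rw [norm_mul, ← one_mul (((‖x₀‖ + 1) * 2) ^ 2), norm_pow]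
    gcongr
    · rw [Real.norm_eq_abs, abs_of_nonneg (pp_nonneg _)]
      exact (pp_le_one (sq_nonneg _))
    · exact (norm_inner_le_norm x y).trans (by gcongr)
  · exact integrable_const _
  · exact .of_forall fun y => by fun_prop

lemma LL_add (x x' : E) : LL ν (x + x') = LL ν x + LL ν x' := by
  have c := pp_cont
  unfold LL
  rw [← integral_add (intble ν hν (by fun_prop)) (intble ν hν (by fun_prop))]
  simp only [inner_add_left, mul_add]

omit [FiniteDimensional ℝ E] [BorelSpace E] [IsFiniteMeasure ν] hν in
lemma LL_smul (t : ℝ) (x : E) : LL ν (t • x) = t * LL ν x := by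
  unfold LL
  rw [← integral_const_mul]
  congr 1; ext y; rw [real_inner_smul_left]; ring

omit [FiniteDimensional ℝ E] [BorelSpace E] [IsFiniteMeasure ν] hν in
lemma QQ_smul (t : ℝ) (x : E) : QQ ν (t • x) = t ^ 2 * QQ ν x := by
  unfold QQ
  rw [← integral_const_mul]
  congr 1; ext y; rw [real_inner_smul_left]; ring

lemma curve (e w : E) (he : ‖e‖ = 1) (v : ℝ → E) (hv : Tendsto v (𝓝[≠] 0) (𝓝 w))
    (hF : ∀ᶠ t in 𝓝[≠] (0:ℝ), FF ν (t • (e + t • v t)) = FF ν 0) :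
    2 * LL ν w - AA ν + 4 * QQ ν e = 0 := by
  have hneg : Tendsto (fun t : ℝ => -t) (𝓝[≠] 0) (𝓝[≠] 0) := by
    apply tendsto_nhdsWithin_of_tendsto_nhds_of_eventually_within
    · have : Tendsto (fun t : ℝ => -t) (𝓝 0) (𝓝 (-0)) := continuous_neg.tendsto 0
      rw [neg_zero] at this
      exact this.mono_left nhdsWithin_le_nhds
    · filter_upwards [self_mem_nhdsWithin] with t ht
      simpa using ht
  have hid : Tendsto (fun t : ℝ => t) (𝓝[≠] 0) (𝓝 0) := nhdsWithin_le_nhds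
  set u : ℝ → E := fun t => e + t • v t with hu
  have hul : Tendsto u (𝓝[≠] 0) (𝓝 e) := by
    have := (tendsto_const_nhds (x := e)).add (hid.smul hv)
    simpa using this
  set m := ν.real univ
  have key : ∀ᶠ t in 𝓝[≠] (0:ℝ), |6 * (t * LL ν e + t ^ 2 * LL ν (v t)) -
      t ^ 2 * (3 * ‖u t‖ ^ 2 * AA ν) + t ^ 2 * (12 * QQ ν (u t))| ≤
        t ^ 2 * (|t| * (152 * ‖u t‖ ^ 3 * m)) := by
    have hsm : Tendsto (fun t => ‖t • u t‖) (𝓝[≠] 0) (𝓝 0) := by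
      have := (hid.smul hul).norm
      simpa using this
    filter_upwards [hF, hsm.eventually (gt_mem_nhds one_pos)] with t ht h1
    have := expand ν hν (t • u t) h1.le
    rw [ht, sub_self, zero_sub, abs_neg, QQ_smul] at this
    have e1 : LL ν (t • u t) = t * LL ν e + t ^ 2 * LL ν (v t) := by
      rw [LL_smul, LL_add ν hν, LL_smul]; ring
    rw [e1, norm_smul, mul_pow, mul_pow, Real.norm_eq_abs, sq_abs] at this
    have e3 : |t| ^ 3 = t ^ 2 * |t| := by rw [pow_succ, sq_abs]
    rw [e3] at this
    convert this using 1
    · congr 1; ring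
    · ring
  have key2 := hneg.eventually key
  have fin : ∀ᶠ t in 𝓝[≠] (0:ℝ), |6 * (LL ν (v t) + LL ν (v (-t))) -
      (3 * ‖u t‖ ^ 2 * AA ν + 3 * ‖u (-t)‖ ^ 2 * AA ν) + (12 * QQ ν (u t) + 12 * QQ ν (u (-t)))| ≤
        |t| * (152 * ‖u t‖ ^ 3 * m) + |t| * (152 * ‖u (-t)‖ ^ 3 * m) := by
    filter_upwards [key, key2, self_mem_nhdsWithin] with t h1 h2 ht
    have ht2 : 0 < t ^ 2 := by
      have : t ≠ 0 := ht
      positivity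
    have h3 := (abs_add_le _ _).trans (add_le_add h1 h2)
    rw [abs_neg, neg_sq] at h3
    refine le_of_mul_le_mul_left ?_ ht2
    rw [mul_add (t ^ 2)]
    refine le_trans (le_of_eq ?_) h3
    rw [← abs_of_pos ht2, ← abs_mul, abs_of_pos ht2]
    congr 1; ring
  have hL := ((LL_cont ν hν).tendsto w).comp hv
  have hQ := ((QQ_cont ν hν).tendsto e).comp hul
  have hN := hul.norm
  have hL' := hL.comp hneg
  have hQ' := hQ.comp hneg
  have hN' := hN.comp hneg
  have lim1 := ((((hL.add hL').const_mul 6).sub (((hN.pow 2).const_mul 3 |>.mul_const (AA ν)).add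
    ((hN'.pow 2).const_mul 3 |>.mul_const (AA ν)))).add
      ((hQ.const_mul 12).add (hQ'.const_mul 12))).abs
  have lim2 := (hid.abs.mul (((hN.pow 3).const_mul 152).mul_const m)).add
    (hid.abs.mul (((hN'.pow 3).const_mul 152).mul_const m))
  have := le_of_tendsto_of_tendsto lim1 lim2 fin
  rw [he] at this
  simp only [abs_zero, zero_mul, add_zero] at this
  have := abs_nonpos_iff.1 this
  linarith
end gen

lemma vol_ball (k : ℕ) (s : ℝ) (hs : 0 < s) :
    (volume (ball (0 : EuclideanSpace ℝ (Fin k)) s)) = ENNReal.ofReal (unitBallVol k * s ^ k) := by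
  have h := Measure.addHaar_ball_mul_of_pos (volume : Measure (EuclideanSpace ℝ (Fin k))) 0 hs 1
  rw [mul_one] at h
  rw [h, finrank_euclideanSpace_fin, mul_comm, unitBallVol, ENNReal.ofReal_mul ENNReal.toReal_nonneg,
    ENNReal.ofReal_toReal measure_ball_lt_top.ne]

lemma radial {n k : ℕ} {μ : Measure (Eu n)} [IsLocallyFiniteMeasure μ] (hμ : LocUniform n k μ)
    {x : Eu n} (hx : x ∈ msupp μ) (h : ℝ → ℝ) (hc : Continuous h) (h1 : ∀ s, 1 ≤ s → h s = 0) :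
    ∫ y, h ‖y - x‖ ∂μ = ∫ y : EuclideanSpace ℝ (Fin k), h ‖y‖ := by
  have : IsFiniteMeasure (μ.restrict (ball x 1)) :=
    ⟨by rw [Measure.restrict_apply_univ]; exact measure_ball_lt_top⟩
  have : IsFiniteMeasure ((volume : Measure (EuclideanSpace ℝ (Fin k))).restrict (ball 0 1)) :=
    ⟨by rw [Measure.restrict_apply_univ]; exact measure_ball_lt_top⟩
  have m1 : Continuous (fun y : Eu n => ‖y - x‖) := by fun_prop
  have m2 : Continuous (fun y : EuclideanSpace ℝ (Fin k) => ‖y‖) := by fun_prop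
  have B : ∀ s : ℝ, μ (ball x (min s 1)) =
      volume (ball (0 : EuclideanSpace ℝ (Fin k)) (min s 1)) := by
    intro s
    rcases le_or_gt s 0 with hs | hs
    · have : min s 1 ≤ 0 := (min_le_left _ _).trans hs
      rw [ball_eq_empty.2 this, ball_eq_empty.2 this]; simp
    · have : 0 < min s 1 := lt_min hs one_pos
      rw [vol_ball k _ this, hμ x hx _ this (min_le_right _ _)]
  have P1 : ∀ s : ℝ, (μ.restrict (ball x 1)) ((fun y : Eu n => ‖y - x‖) ⁻¹' (Iio s)) =
      μ (ball x (min s 1)) := by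
    intro s
    rw [Measure.restrict_apply (m1.measurable measurableSet_Iio)]
    congr 1; ext y; simp [dist_eq_norm]
  have P2 : ∀ s : ℝ, (volume.restrict (ball (0 : EuclideanSpace ℝ (Fin k)) 1))
      ((fun y => ‖y‖) ⁻¹' (Iio s)) = volume (ball (0 : EuclideanSpace ℝ (Fin k)) (min s 1)) := by
    intro s
    rw [Measure.restrict_apply (m2.measurable measurableSet_Iio)]
    congr 1; ext y; simp
  have U : (μ.restrict (ball x 1)) univ =
      (volume.restrict (ball (0 : EuclideanSpace ℝ (Fin k)) 1)) univ := by
    simpa using B 1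
  have M : Measure.map (fun y : Eu n => ‖y - x‖) (μ.restrict (ball x 1)) =
      Measure.map (fun y => ‖y‖) (volume.restrict (ball (0 : EuclideanSpace ℝ (Fin k)) 1)) := by
    apply Measure.ext_of_Ici
    intro s
    rw [Measure.map_apply m1.measurable measurableSet_Ici,
      Measure.map_apply m2.measurable measurableSet_Ici, ← compl_Iio, preimage_compl, preimage_compl,
      measure_compl (m1.measurable measurableSet_Iio) (measure_ne_top _ _),
      measure_compl (m2.measurable measurableSet_Iio) (measure_ne_top _ _), P1, P2, B, U]
  rw [← setIntegral_eq_integral_of_forall_compl_eq_zero (s := ball x 1),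
    ← setIntegral_eq_integral_of_forall_compl_eq_zero (s := ball (0 : EuclideanSpace ℝ (Fin k)) 1),
    ← integral_map (φ := fun y : Eu n => ‖y - x‖) m1.aemeasurable hc.aestronglyMeasurable, M,
    integral_map m2.aemeasurable hc.aestronglyMeasurable]
  · intro y hy; apply h1; simpa using hy
  · intro y hy; apply h1; simpa [dist_eq_norm] using hy

lemma lim2 {k : ℕ} (f : EuclideanSpace ℝ (Fin k) → ℝ) (hf : ContDiff ℝ 2 f) (hf0 : f 0 = 0)
    (hd : fderiv ℝ f 0 = 0) (e : EuclideanSpace ℝ (Fin k)) :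
    Tendsto (fun t : ℝ => f (t • e) / t ^ 2) (𝓝[≠] 0)
      (𝓝 (fderiv ℝ (fun x => fderiv ℝ f x e) 0 e / 2)) := by
  have hl : ∀ t : ℝ, HasDerivAt (fun t : ℝ => t • e) e t := fun t => by
    simpa using (hasDerivAt_id t).smul_const e
  have D1 : ∀ t : ℝ, HasDerivAt (fun t : ℝ => f (t • e)) (fderiv ℝ f (t • e) e) t := fun t =>
    ((hf.differentiable (by norm_num)) (t • e)).hasFDerivAt.comp_hasDerivAt t (hl t)
  have hf1 : ContDiff ℝ 1 (fderiv ℝ f) := hf.fderiv_right (by norm_num)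
  have hg : Differentiable ℝ (fun x => fderiv ℝ f x e) := by
    have := hf1.differentiable (by norm_num)
    fun_prop
  have D2 : HasDerivAt (fun t : ℝ => fderiv ℝ f (t • e) e)
      (fderiv ℝ (fun x => fderiv ℝ f x e) 0 e) 0 := by
    have h2 : HasFDerivAt (fun x => fderiv ℝ f x e) (fderiv ℝ (fun x => fderiv ℝ f x e) 0)
      ((0:ℝ) • e) := by rw [zero_smul]; exact (hg 0).hasFDerivAt
    exact h2.comp_hasDerivAt (0:ℝ) (hl 0)
  have hT : ∀ (g : ℝ → ℝ), Continuous g → g 0 = 0 → Tendsto g (𝓝[≠] 0) (𝓝 0) := by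
    intro g hg h0
    have := hg.tendsto 0
    rw [h0] at this
    exact this.mono_left nhdsWithin_le_nhds
  apply HasDerivAt.lhopital_zero_nhdsNE (f' := fun t => fderiv ℝ f (t • e) e)
    (g' := fun t : ℝ => 2 * t)
  · exact .of_forall D1
  · exact .of_forall fun t => by simpa using hasDerivAt_pow 2 t
  · filter_upwards [self_mem_nhdsWithin] with t ht
    have : t ≠ 0 := ht
    simpa using this
  · apply hT
    · have := hf.continuous
      fun_prop
    · simp [hf0]
  · apply hT
    · fun_prop
    · simp
  · have := D2.tendsto_slope
    have h3 := this.div_const 2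
    refine h3.congr' ?_
    filter_upwards with t
    simp [slope_def_field, hd]
    rw [div_div, mul_comm]

lemma res_fin {E : Type*} [NormedAddCommGroup E] [ProperSpace E] [MeasurableSpace E]
    (μ : Measure E) [IsLocallyFiniteMeasure μ] : IsFiniteMeasure (μ.restrict (ball (0:E) 2)) :=
  ⟨by rw [Measure.restrict_apply_univ]; exact measure_ball_lt_top⟩

lemma res_ae {E : Type*} [NormedAddCommGroup E] [MeasurableSpace E] [BorelSpace E]
    (μ : Measure E) : ∀ᵐ y ∂(μ.restrict (ball (0:E) 2)), ‖y‖ ≤ 2 := by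
  filter_upwards [ae_restrict_mem measurableSet_ball] with y hy
  simp at hy; exact hy.le

lemma res_int {E : Type*} [NormedAddCommGroup E] [MeasurableSpace E]
    (μ : Measure E) (x : E) (hx : ‖x‖ ≤ 1) (f : E → ℝ) (hf : ∀ y, 1 ≤ ‖y - x‖ → f y = 0) :
    ∫ y, f y ∂(μ.restrict (ball (0:E) 2)) = ∫ y, f y ∂μ := by
  apply setIntegral_eq_integral_of_forall_compl_eq_zero
  intro y hy
  apply hf
  simp at hy
  have := norm_sub_norm_le y x
  linarith

lemma one_le_sq' {s : ℝ} (h : 1 ≤ s) : 1 ≤ s ^ 2 := by nlinarith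

lemma FF_res {E : Type*} [NormedAddCommGroup E] [InnerProductSpace ℝ E] [MeasurableSpace E]
    (μ : Measure E) (x : E) (hx : ‖x‖ ≤ 1) :
    FF (μ.restrict (ball (0:E) 2)) x = ∫ y, pp (‖y - x‖ ^ 2) ^ 3 ∂μ := by
  unfold FF
  apply res_int μ x hx
  intro y hy
  rw [pp_zero (one_le_sq' hy)]; simp

lemma flat_id (k : ℕ) :
    -(k : ℝ) * (∫ y : EuclideanSpace ℝ (Fin k), pp (‖y‖ ^ 2) ^ 2) +
      4 * ∫ y : EuclideanSpace ℝ (Fin k), pp (‖y‖ ^ 2) * ‖y‖ ^ 2 = 0 := by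
  set V := (volume : Measure (EuclideanSpace ℝ (Fin k)))
  set ν := V.restrict (ball 0 2) with hνd
  have : IsFiniteMeasure ν := res_fin V
  have hν := res_ae V
  have c := pp_cont
  have key : ∀ i : Fin k, - AA ν + 4 * QQ ν (EuclideanSpace.single i 1) = 0 := by
    intro i
    have := curve ν hν (EuclideanSpace.single i 1) 0 (by simp) (fun _ => 0) tendsto_const_nhds ?_
    · have l0 : LL ν 0 = 0 := by simp [LL]
      rw [l0] at this; linarith
    · have : ∀ᶠ t in 𝓝[≠] (0:ℝ), |t| < 1 := by
        have : Tendsto (fun t : ℝ => |t|) (𝓝[≠] 0) (𝓝 |0|) :=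
          (continuous_abs.tendsto 0).mono_left nhdsWithin_le_nhds
        rw [abs_zero] at this
        exact this.eventually (gt_mem_nhds one_pos)
      filter_upwards [this] with t ht
      rw [FF_res V _ (by simp [norm_smul, ht.le]), FF_res V _ (by simp)]
      rw [integral_sub_right_eq_self (fun y => pp (‖y‖ ^ 2) ^ 3)]
      simp
  have hs : ∑ i : Fin k, (- AA ν + 4 * QQ ν (EuclideanSpace.single i 1)) = 0 :=
    Finset.sum_eq_zero fun i _ => key i
  rw [Finset.sum_add_distrib, ← Finset.mul_sum] at hs
  have hq : ∑ i : Fin k, QQ ν (EuclideanSpace.single i 1) = ∫ y, pp (‖y‖ ^ 2) * ‖y‖ ^ 2 ∂V := by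
    unfold QQ
    rw [← integral_finsetSum _ (fun i _ => intble ν hν (by fun_prop))]
    rw [← res_int V 0 (by simp)]
    · congr 1; ext y
      rw [EuclideanSpace.real_norm_sq_eq, Finset.mul_sum]
      simp [EuclideanSpace.inner_single_left]
    · intro y hy; rw [sub_zero] at hy; rw [pp_zero (one_le_sq' hy)]; simp
  have ha : AA ν = ∫ y, pp (‖y‖ ^ 2) ^ 2 ∂V := by
    unfold AA
    rw [← res_int V 0 (by simp)]
    intro y hy; rw [sub_zero] at hy; rw [pp_zero (one_le_sq' hy)]; simp
  rw [hq, ha] at hs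
  simpa using hs

/-- Strong unique continuation, local version: if the support is a `C²`
graph over its tangent plane at `0` and `Δφ_j(0) = 0` for all `j ≥ k` (vanishing mean
curvature), then the support is flat in every ball `B(0,r)`, `0 < r < 1/2`. -/
theorem stmt6 (n k : ℕ) (hk : k ≤ n + 1) (μ : Measure (Eu n)) [IsLocallyFiniteMeasure μ]
    (hμ : LocUniform n k μ) (h0 : (0 : Eu n) ∈ msupp μ) (r₀ : ℝ) (hr₀ : 0 < r₀)
    (φ : Fin (n + 1) → EuclideanSpace ℝ (Fin k) → ℝ)
    (hφC2 : ∀ j : Fin (n + 1), k ≤ (j : ℕ) → ContDiff ℝ 2 (φ j))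
    (hφ0 : ∀ j : Fin (n + 1), k ≤ (j : ℕ) → φ j 0 = 0)
    (hφd : ∀ j : Fin (n + 1), k ≤ (j : ℕ) → fderiv ℝ (φ j) 0 = 0)
    (hgraph : msupp μ ∩ ball (0 : Eu n) r₀ = Set.range (graphMap n k φ) ∩ ball (0 : Eu n) r₀)
    (hmc : ∀ j : Fin (n + 1), k ≤ (j : ℕ) → lap0 k (φ j) = 0) :
    ∀ r : ℝ, 0 < r → r < 1 / 2 →
      msupp μ ∩ ball (0 : Eu n) r ⊆ {x : Eu n | ∀ j : Fin (n + 1), k ≤ (j : ℕ) → x j = 0} := by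
  have c := pp_cont
  set ν := μ.restrict (ball 0 2) with hνd
  have : IsFiniteMeasure ν := res_fin μ
  have hν := res_ae μ
  -- radial integrals
  have hA : AA ν = ∫ y : EuclideanSpace ℝ (Fin k), pp (‖y‖ ^ 2) ^ 2 := by
    have := radial hμ h0 (fun s => pp (s ^ 2) ^ 2) (by fun_prop)
      (fun s hs => by rw [pp_zero (one_le_sq' hs)]; simp)
    simp only [sub_zero] at this
    rw [← this, ← res_int μ 0 (by simp)]
    · rfl
    · intro y hy; rw [sub_zero] at hy; rw [pp_zero (one_le_sq' hy)]; simp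
  have hR : ∫ y, pp (‖y‖ ^ 2) * ‖y‖ ^ 2 ∂ν =
      ∫ y : EuclideanSpace ℝ (Fin k), pp (‖y‖ ^ 2) * ‖y‖ ^ 2 := by
    have := radial hμ h0 (fun s => pp (s ^ 2) * s ^ 2) (by fun_prop)
      (fun s hs => by rw [pp_zero (one_le_sq' hs)]; simp)
    simp only [sub_zero] at this
    rw [← this, ← res_int μ 0 (by simp)]
    · intro y hy; rw [sub_zero] at hy; rw [pp_zero (one_le_sq' hy)]; simp
  have hFF : ∀ x ∈ msupp μ, ‖x‖ ≤ 1 → FF ν x = FF ν 0 := by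
    intro x hx hx1
    rw [FF_res μ x hx1, FF_res μ 0 (by simp)]
    have h3 : ∀ s : ℝ, 1 ≤ s → pp (s ^ 2) ^ 3 = 0 :=
      fun s hs => by rw [pp_zero (one_le_sq' hs)]; simp
    rw [radial hμ hx (fun s => pp (s ^ 2) ^ 3) (by fun_prop) h3,
      radial hμ h0 (fun s => pp (s ^ 2) ^ 3) (by fun_prop) h3]
  -- curves
  let e : Fin k → Eu n := fun i => EuclideanSpace.single (Fin.castLE hk i) 1
  let v : Fin k → ℝ → Eu n := fun i t => WithLp.toLp 2 (fun j : Fin (n + 1) =>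
    if (j : ℕ) < k then 0 else φ j (t • EuclideanSpace.single i 1) / t ^ 2)
  let w : Fin k → Eu n := fun i => WithLp.toLp 2 (fun j : Fin (n + 1) =>
    if (j : ℕ) < k then 0 else
      fderiv ℝ (fun x => fderiv ℝ (φ j) x (EuclideanSpace.single i 1)) 0
        (EuclideanSpace.single i 1) / 2)
  have hvw : ∀ i, Tendsto (v i) (𝓝[≠] 0) (𝓝 (w i)) := by
    intro i
    apply ((PiLp.continuous_toLp 2 (fun _ : Fin (n + 1) => ℝ)).tendsto _).comp
    rw [tendsto_pi_nhds]
    intro j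
    by_cases hj : (j : ℕ) < k
    · simp only [hj, if_true]; exact tendsto_const_nhds
    · simp only [hj, if_false]
      have hj' := not_lt.1 hj
      exact lim2 (φ j) (hφC2 j hj') (hφ0 j hj') (hφd j hj') _
  have hgr : ∀ i, ∀ t : ℝ, t ≠ 0 →
      t • (e i + t • v i t) = graphMap n k φ (t • EuclideanSpace.single i 1) := by
    intro i t ht
    ext j
    by_cases hj : (j : ℕ) < k
    · simp [graphMap, e, v, hj, Fin.ext_iff, Pi.single_apply]
    · have : j ≠ Fin.castLE hk i := by
        rintro rfl; exact hj (by simp)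
      simp [graphMap, e, v, hj, this]
      field_simp
  have hcur : ∀ i, 2 * LL ν (w i) - AA ν + 4 * QQ ν (e i) = 0 := by
    intro i
    apply curve ν hν (e i) (w i) (by simp [e]) (v i) (hvw i)
    have hid : Tendsto (fun t : ℝ => t) (𝓝[≠] 0) (𝓝 0) := nhdsWithin_le_nhds
    have hl : Tendsto (fun t : ℝ => t • (e i + t • v i t)) (𝓝[≠] 0) (𝓝 0) := by
      have := hid.smul ((tendsto_const_nhds (x := e i)).add (hid.smul (hvw i)))
      simpa using this
    filter_upwards [hl.eventually (ball_mem_nhds 0 hr₀), hl.eventually (ball_mem_nhds 0 one_pos),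
      self_mem_nhdsWithin] with t h1 h2 h3
    apply hFF
    · have : t • (e i + t • v i t) ∈ msupp μ ∩ ball (0 : Eu n) r₀ := by
        rw [hgraph]
        exact ⟨⟨_, (hgr i t h3).symm⟩, h1⟩
      exact this.1
    · simpa using (mem_ball_zero_iff.1 h2).le
  have hw : ∑ i, w i = 0 := by
    ext j
    by_cases hj : (j : ℕ) < k
    · simp [w, hj]
    · have := hmc j (not_lt.1 hj)
      unfold lap0 at this
      simp [w, hj, ← Finset.sum_div, this]
  have hLs : ∑ i, LL ν (w i) = 0 := by
    have : ∀ s : Finset (Fin k), ∑ i ∈ s, LL ν (w i) = LL ν (∑ i ∈ s, w i) := by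
      intro s
      induction s using Finset.induction_on with
      | empty => simp [LL]
      | insert a s ha ih => rw [Finset.sum_insert ha, Finset.sum_insert ha, LL_add ν hν, ih]
    rw [this, hw]; simp [LL]
  have hsum : ∑ i, (2 * LL ν (w i) - AA ν + 4 * QQ ν (e i)) = 0 :=
    Finset.sum_eq_zero fun i _ => hcur i
  rw [Finset.sum_add_distrib, Finset.sum_sub_distrib, ← Finset.mul_sum, ← Finset.mul_sum, hLs] at hsum
  simp only [Finset.sum_const, Finset.card_univ, Fintype.card_fin, nsmul_eq_mul] at hsum
  have hflat := flat_id k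
  rw [← hA, ← hR] at hflat
  have hdiff : ∫ y, pp (‖y‖ ^ 2) * ‖y‖ ^ 2 ∂ν - ∑ i, QQ ν (e i) = 0 := by linarith
  have hcast : ∀ y : Eu n, ∑ i : Fin k, (y (Fin.castLE hk i)) ^ 2 =
      ∑ j : Fin (n + 1), if (j : ℕ) < k then (y j) ^ 2 else 0 := by
    intro y
    rw [← Finset.sum_filter]
    refine Finset.sum_bij (fun i _ => Fin.castLE hk i) ?_ ?_ ?_ ?_
    · intro i _; simp
    · intro i _ i' _ h; simpa using h
    · intro j hj
      simp only [Finset.mem_filter, Finset.mem_univ, true_and] at hj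
      exact ⟨⟨j, hj⟩, by simp, by ext; simp⟩
    · intro i _; rfl
  have hint : ∫ y : Eu n, pp (‖y‖ ^ 2) *
      (∑ j : Fin (n + 1), if (j : ℕ) < k then 0 else (y j) ^ 2) ∂ν = 0 := by
    refine Eq.trans ?_ hdiff
    unfold QQ
    rw [← integral_finsetSum _ (fun i _ => intble ν hν (by fun_prop)),
      ← integral_sub (intble ν hν (by fun_prop)) (intble ν hν (by fun_prop))]
    congr 1; ext y
    rw [← Finset.mul_sum, ← mul_sub]
    congr 1
    have : ∀ i, ⟪e i, y⟫ = y (Fin.castLE hk i) := fun i => by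
      simp [e, EuclideanSpace.inner_single_left]
    simp only [this]
    rw [hcast, EuclideanSpace.real_norm_sq_eq, ← Finset.sum_sub_distrib]
    apply Finset.sum_congr rfl
    intro j _
    split_ifs <;> simp
  have hcn : Continuous (fun y : Eu n => pp (‖y‖ ^ 2) *
      (∑ j : Fin (n + 1), if (j : ℕ) < k then 0 else (y j) ^ 2)) := by
    refine (by fun_prop : Continuous fun y : Eu n => pp (‖y‖ ^ 2)).mul
      (continuous_finsetSum _ fun j _ => ?_)
    split_ifs <;> fun_prop
  have hnn : ∀ y : Eu n, ∀ j : Fin (n + 1), 0 ≤ (if (j : ℕ) < k then 0 else (y j) ^ 2) := by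
    intro y j; split_ifs <;> positivity
  rw [integral_eq_zero_iff_of_nonneg
    (fun y => mul_nonneg (pp_nonneg _) (Finset.sum_nonneg fun j _ => hnn y j))
    (intble ν hν hcn)] at hint
  rintro r hr hr2 x ⟨hx, hxr⟩ j hj
  by_contra hne
  have hxr' : ‖x‖ < r := by simpa using hxr
  have hop : IsOpen {y : Eu n | ‖y‖ < 1 ∧ y j ≠ 0} := by
    apply IsOpen.inter
    · exact isOpen_lt continuous_norm continuous_const
    · exact isOpen_ne_fun (by fun_prop) continuous_const
  obtain ⟨ε, hε, hsub⟩ := Metric.isOpen_iff.1 hop x ⟨by linarith, hne⟩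
  have hpos := hx ε hε
  rw [EventuallyEq, ae_restrict_iff' measurableSet_ball] at hint
  have hz : ∀ᵐ y ∂μ, y ∉ ball x ε := by
    filter_upwards [hint] with y hy hyb
    obtain ⟨h1, h2⟩ := hsub hyb
    have := hy (by simp; linarith)
    simp only [Pi.zero_apply] at this
    have hp : 0 < pp (‖y‖ ^ 2) := by
      unfold pp
      apply lt_max_of_lt_left
      nlinarith [norm_nonneg y]
    have h3 := (mul_eq_zero.1 this).resolve_left hp.ne'
    rw [Finset.sum_eq_zero_iff_of_nonneg (fun j _ => hnn y j)] at h3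
    have h4 := h3 j (Finset.mem_univ _)
    rw [if_neg (not_lt.2 hj)] at h4
    exact h2 (by simpa using h4)
  have hz' : μ (ball x ε) = 0 := by
    have := ae_iff.1 hz
    simp only [not_not] at this
    exact this
  exact hpos.ne' hz'
end
end
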